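/- arXiv:math/0701500 — 11 statements merged into one kernel-verified Lean document; each statement's English description precedes it below -/
import Mathlib

section
/- Let n ≥ 1 and let P₁, P₂, P₃, P₄ be n×n real matrices whose graphs 𝒫ᵢ = Γ(Pᵢ) = {(f, Pᵢf) : f ∈ ℝⁿ} ⊆ ℝⁿ × ℝⁿ satisfy 𝒫₁ ⊕ 𝒫₂ = 𝒫₃ ⊕ 𝒫₄ = ℝ²ⁿ (equivalently, P₁ − P₂ and P₃ − P₄ are invertible). Then the composition of the projection of 𝒫₁ onto 𝒫₃ parallel to 𝒫₄, followed by the projection of 𝒫₃ onto 𝒫₁ parallel to 𝒫₂, sends (f, P₁f) to (h, P₁h) where h = (P₁−P₂)⁻¹(P₂−P₃)(P₃−P₄)⁻¹(P₄−P₁) f; i.e., in the graph coordinate f, this composite map 𝒫₁ → 𝒫₁ has matrix (P₁−P₂)⁻¹(P₂−P₃)(P₃−P₄)⁻¹(P₄−P₁). -/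
theorem isUnit_det_aux {n : ℕ} (A B : Matrix (Fin n) (Fin n) ℝ)
    (h : IsCompl (LinearMap.graph A.mulVecLin) (LinearMap.graph B.mulVecLin)) :
    IsUnit (A - B).det := by
  rw [isUnit_iff_ne_zero]
  intro h0
  obtain ⟨v, hv, hv0⟩ := Matrix.exists_mulVec_eq_zero_iff.mpr h0
  rw [Matrix.sub_mulVec, sub_eq_zero] at hv0
  have h1 : (v, A.mulVec v) ∈ LinearMap.graph A.mulVecLin := by simp
  have h2 : (v, A.mulVec v) ∈ LinearMap.graph B.mulVecLin := by simp [hv0]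
  have := Submodule.disjoint_def.mp h.disjoint _ h1 h2
  exact hv (congrArg Prod.fst this)

theorem proj_aux {n : ℕ} (A B : Matrix (Fin n) (Fin n) ℝ)
    (h : IsCompl (LinearMap.graph A.mulVecLin) (LinearMap.graph B.mulVecLin))
    (x y : Fin n → ℝ) :
    (((LinearMap.graph A.mulVecLin).projectionOnto (LinearMap.graph B.mulVecLin) h (x, y)) :
      (Fin n → ℝ) × (Fin n → ℝ)) =
      ((A - B)⁻¹.mulVec (y - B.mulVec x), A.mulVec ((A - B)⁻¹.mulVec (y - B.mulVec x))) := by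
  have hu := isUnit_det_aux A B h
  have hb : (x, y) - (((LinearMap.graph A.mulVecLin).projectionOnto
      (LinearMap.graph B.mulVecLin) h (x, y)) : (Fin n → ℝ) × (Fin n → ℝ))
      ∈ LinearMap.graph B.mulVecLin := by
    rw [← Submodule.projectionOnto_apply_eq_zero_iff h, map_sub,
      Submodule.projectionOnto_apply_left, sub_self]
  have ha := ((LinearMap.graph A.mulVecLin).projectionOnto
      (LinearMap.graph B.mulVecLin) h (x, y)).2
  generalize (((LinearMap.graph A.mulVecLin).projectionOnto
      (LinearMap.graph B.mulVecLin) h (x, y)) : (Fin n → ℝ) × (Fin n → ℝ)) = u at ha hb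
  obtain ⟨g, k⟩ := u
  simp only [LinearMap.mem_graph_iff, Matrix.mulVecLin_apply, Prod.fst_sub, Prod.snd_sub,
    Matrix.mulVec_sub] at ha hb
  subst ha
  have e : y - B.mulVec x = (A - B).mulVec g := by
    rw [Matrix.sub_mulVec, sub_eq_sub_iff_add_eq_add]
    rw [sub_eq_sub_iff_add_eq_add] at hb
    rw [add_comm (A.mulVec g), add_comm (B.mulVec x)] at *
    simpa [add_comm] using hb
  rw [e, Matrix.mulVec_mulVec, Matrix.nonsing_inv_mul _ hu, Matrix.one_mulVec]

/-- Let `P₁ P₂ P₃ P₄` be n×n real matrices whose graphs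
`𝒫ᵢ = {(f, Pᵢ f)} ⊆ ℝⁿ × ℝⁿ` satisfy `𝒫₁ ⊕ 𝒫₂ = 𝒫₃ ⊕ 𝒫₄ = ℝ²ⁿ`.  Then the composition of
the projection of `𝒫₁` onto `𝒫₃` parallel to `𝒫₄` followed by the projection of `𝒫₃`
onto `𝒫₁` parallel to `𝒫₂` sends `(f, P₁ f)` to `(h, P₁ h)` with
`h = (P₁ - P₂)⁻¹ (P₂ - P₃) (P₃ - P₄)⁻¹ (P₄ - P₁) f`. -/
theorem crossRatio_matrix_of_graphs
    (n : ℕ) (hn : 1 ≤ n) (P₁ P₂ P₃ P₄ : Matrix (Fin n) (Fin n) ℝ)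
    (h12 : IsCompl (LinearMap.graph P₁.mulVecLin) (LinearMap.graph P₂.mulVecLin))
    (h34 : IsCompl (LinearMap.graph P₃.mulVecLin) (LinearMap.graph P₄.mulVecLin))
    (f : Fin n → ℝ) :
    (↑((LinearMap.graph P₁.mulVecLin).linearProjOfIsCompl
          (LinearMap.graph P₂.mulVecLin) h12
        ↑((LinearMap.graph P₃.mulVecLin).linearProjOfIsCompl
            (LinearMap.graph P₄.mulVecLin) h34
          (f, P₁.mulVec f))) :
        (Fin n → ℝ) × (Fin n → ℝ)) =
      (((P₁ - P₂)⁻¹ * (P₂ - P₃) * (P₃ - P₄)⁻¹ * (P₄ - P₁)).mulVec f,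
        P₁.mulVec (((P₁ - P₂)⁻¹ * (P₂ - P₃) * (P₃ - P₄)⁻¹ * (P₄ - P₁)).mulVec f)) := by
  have e1 := proj_aux P₃ P₄ h34 f (P₁.mulVec f)
  have key : ∀ g : Fin n → ℝ, P₃.mulVec g - P₂.mulVec g = -((P₂ - P₃).mulVec g) := by
    intro g
    rw [Matrix.sub_mulVec, neg_sub]
  have e2 : P₁.mulVec f - P₄.mulVec f = -((P₄ - P₁).mulVec f) := by
    rw [Matrix.sub_mulVec, neg_sub]
  rw [e2] at e1
  have e3 := proj_aux P₁ P₂ h12 ((P₃ - P₄)⁻¹.mulVec (-((P₄ - P₁).mulVec f)))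
    (P₃.mulVec ((P₃ - P₄)⁻¹.mulVec (-((P₄ - P₁).mulVec f))))
  rw [← e1, key] at e3
  refine e3.trans ?_
  simp only [Matrix.mulVec_neg, neg_neg, Matrix.mulVec_mulVec, Matrix.mul_assoc]
end

section
/- Let k, l ≥ 1, let P₁, P₃ be l×k real matrices (linear maps ℝᵏ → ℝˡ) and P₂, P₄ be k×l real matrices (linear maps ℝˡ → ℝᵏ). Consider in H = ℝᵏ × ℝˡ the subspaces 𝒫₁ = {(f, P₁f)}, 𝒫₃ = {(g, P₃g)} (graphs over the horizontal factor ℝᵏ) and 𝒫₂ = {(P₂g, g)}, 𝒫₄ = {(P₄g, g)} (graphs over the vertical factor ℝˡ). Assume that the k×k matrices P₂P₁ − I and P₄P₃ − I are invertible. Then the composition of the projection of 𝒫₁ onto 𝒫₃ parallel to 𝒫₄, followed by the projection of 𝒫₃ onto 𝒫₁ parallel to 𝒫₂, sends (f, P₁f) to (h, P₁h) where h = (P₂P₁ − I)⁻¹(P₂P₃ − I)(P₄P₃ − I)⁻¹(P₄P₁ − I) f. -/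
/-- The "vertical" graph `{(B g, g) : g ∈ ℝˡ}` of a matrix `B : ℝˡ → ℝᵏ`,
as a subspace of `ℝᵏ × ℝˡ`. -/
noncomputable def verticalGraph {k l : ℕ} (B : Matrix (Fin k) (Fin l) ℝ) :
    Submodule ℝ ((Fin k → ℝ) × (Fin l → ℝ)) :=
  (LinearMap.graph B.mulVecLin).map
    (LinearEquiv.prodComm ℝ (Fin l → ℝ) (Fin k → ℝ)).toLinearMap

theorem proj_graph_aux {k l : ℕ} (A P : Matrix (Fin l) (Fin k) ℝ) (B : Matrix (Fin k) (Fin l) ℝ)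
    (hu : IsUnit (B * A - 1))
    (h : IsCompl (LinearMap.graph A.mulVecLin) (verticalGraph B)) (f : Fin k → ℝ) :
    (((LinearMap.graph A.mulVecLin).projectionOnto (verticalGraph B) h (f, P.mulVec f) :
      LinearMap.graph A.mulVecLin) : (Fin k → ℝ) × (Fin l → ℝ)) =
    (((B * A - 1)⁻¹ * (B * P - 1)).mulVec f,
      A.mulVec (((B * A - 1)⁻¹ * (B * P - 1)).mulVec f)) := by
  have h1 := Submodule.sub_projection_mem h (f, P.mulVec f)
  rw [← Submodule.coe_projectionOnto_apply] at h1
  generalize (LinearMap.graph A.mulVecLin).projectionOnto (verticalGraph B) h (f, P.mulVec f) = y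
    at h1 ⊢
  obtain ⟨⟨a, b⟩, hy⟩ := y
  rw [LinearMap.mem_graph_iff] at hy
  simp only [Matrix.mulVecLin_apply] at hy
  subst hy
  obtain ⟨⟨c, d⟩, hz, he⟩ := h1
  have hz' : d = B.mulVec c := hz
  have e1 : d = f - a := congrArg Prod.fst he
  have e2 : c = P.mulVec f - A.mulVec a := congrArg Prod.snd he
  subst e2
  have key : (B * A - 1).mulVec a = (B * P - 1).mulVec f := by
    rw [e1, Matrix.mulVec_sub, Matrix.mulVec_mulVec, Matrix.mulVec_mulVec] at hz'
    rw [Matrix.sub_mulVec, Matrix.sub_mulVec, Matrix.one_mulVec, Matrix.one_mulVec]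
    rw [sub_eq_sub_iff_add_eq_add] at hz' ⊢
    rw [add_comm, hz']
  have ha : a = ((B * A - 1)⁻¹ * (B * P - 1)).mulVec f := by
    rw [← Matrix.mulVec_mulVec, ← key, Matrix.mulVec_mulVec,
      Matrix.nonsing_inv_mul _ ((Matrix.isUnit_iff_isUnit_det _).1 hu), Matrix.one_mulVec]
  rw [← ha]

/-- Let `P₁ P₃ : ℝᵏ → ℝˡ` and `P₂ P₄ : ℝˡ → ℝᵏ`, and consider in
`H = ℝᵏ × ℝˡ` the horizontal graphs `𝒫₁ = {(f, P₁ f)}`, `𝒫₃ = {(g, P₃ g)}` and the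
vertical graphs `𝒫₂ = {(P₂ g, g)}`, `𝒫₄ = {(P₄ g, g)}`.  If `P₂ P₁ - I` and
`P₄ P₃ - I` are invertible, then the composition of the projection of `𝒫₁` onto `𝒫₃`
parallel to `𝒫₄` followed by the projection of `𝒫₃` onto `𝒫₁` parallel to `𝒫₂` sends
`(f, P₁ f)` to `(h, P₁ h)` with
`h = (P₂ P₁ - I)⁻¹ (P₂ P₃ - I) (P₄ P₃ - I)⁻¹ (P₄ P₁ - I) f`. -/
theorem crossRatio_matrix_mixed_graphs
    (k l : ℕ) (hk : 1 ≤ k) (hl : 1 ≤ l)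
    (P₁ P₃ : Matrix (Fin l) (Fin k) ℝ) (P₂ P₄ : Matrix (Fin k) (Fin l) ℝ)
    (hu12 : IsUnit (P₂ * P₁ - 1)) (hu34 : IsUnit (P₄ * P₃ - 1))
    (h12 : IsCompl (LinearMap.graph P₁.mulVecLin) (verticalGraph P₂))
    (h34 : IsCompl (LinearMap.graph P₃.mulVecLin) (verticalGraph P₄))
    (f : Fin k → ℝ) :
    (↑((LinearMap.graph P₁.mulVecLin).linearProjOfIsCompl (verticalGraph P₂) h12
        ↑((LinearMap.graph P₃.mulVecLin).linearProjOfIsCompl (verticalGraph P₄) h34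
          (f, P₁.mulVec f))) :
        (Fin k → ℝ) × (Fin l → ℝ)) =
      (((P₂ * P₁ - 1)⁻¹ * (P₂ * P₃ - 1) * (P₄ * P₃ - 1)⁻¹ * (P₄ * P₁ - 1)).mulVec f,
        P₁.mulVec
          (((P₂ * P₁ - 1)⁻¹ * (P₂ * P₃ - 1) * (P₄ * P₃ - 1)⁻¹ * (P₄ * P₁ - 1)).mulVec f)) := by
  have e := proj_graph_aux P₃ P₁ P₄ hu34 h34 f
  have e' := proj_graph_aux P₁ P₃ P₂ hu12 h12 (((P₄ * P₃ - 1)⁻¹ * (P₄ * P₁ - 1)).mulVec f)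
  rw [← e, Matrix.mulVec_mulVec] at e'
  simp only [← Matrix.mul_assoc] at e'
  exact e'
end

section
/- Let V be a vector space over a field K and let P₁, P₂, P₃, P₄ be subspaces such that all four pairs (P₁,P₂), (P₃,P₄), (P₁,P₄), (P₃,P₂) are complementary (each pair gives a direct sum decomposition of V). Then DV(P₁,P₂;P₃,P₄) ∘ DV(P₁,P₄;P₃,P₂) = id on P₁; that is, DV(P₁,P₂;P₃,P₄) = DV(P₁,P₄;P₃,P₂)⁻¹. -/
/-- The operator cross ratio `DV(P₁,P₂;P₃,P₄) : P₁ → P₁`: the projection onto `P₃`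
parallel to `P₄` restricted to `P₁`, followed by the projection onto `P₁` parallel
to `P₂` restricted to `P₃`. -/
noncomputable def DV {K V : Type*} [Field K] [AddCommGroup V] [Module K V]
    (P₁ P₂ P₃ P₄ : Submodule K V) (h12 : IsCompl P₁ P₂) (h34 : IsCompl P₃ P₄) :
    P₁ →ₗ[K] P₁ :=
  (P₁.linearProjOfIsCompl P₂ h12) ∘ₗ P₃.subtype ∘ₗ
    (P₃.linearProjOfIsCompl P₄ h34) ∘ₗ P₁.subtype

theorem aux_proj {K V : Type*} [Field K] [AddCommGroup V] [Module K V]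
    (p q : Submodule K V) (h : IsCompl p q) (a : p) (b : V) (hb : b - a ∈ q) :
    p.projectionOnto q h b = a := by
  have := (Submodule.projectionOnto_apply_eq_zero_iff h).2 hb
  rw [map_sub, Submodule.projectionOnto_apply_left, sub_eq_zero] at this
  exact this

theorem aux_sub {K V : Type*} [Field K] [AddCommGroup V] [Module K V]
    (p q : Submodule K V) (h : IsCompl p q) (b : V) :
    b - (p.projectionOnto q h b : V) ∈ q := by
  rw [← Submodule.projectionOnto_apply_eq_zero_iff h, map_sub,
    Submodule.projectionOnto_apply_left, sub_self]

/-- If the pairs `(P₁,P₂)`, `(P₃,P₄)`, `(P₁,P₄)`, `(P₃,P₂)` are all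
complementary, then `DV(P₁,P₂;P₃,P₄) ∘ DV(P₁,P₄;P₃,P₂) = id` on `P₁`, i.e.
`DV(P₁,P₂;P₃,P₄)` is inverse to `DV(P₁,P₄;P₃,P₂)`. -/
theorem DV_comp_DV_swapped_eq_id {K V : Type*} [Field K] [AddCommGroup V] [Module K V]
    (P₁ P₂ P₃ P₄ : Submodule K V)
    (h12 : IsCompl P₁ P₂) (h34 : IsCompl P₃ P₄)
    (h14 : IsCompl P₁ P₄) (h32 : IsCompl P₃ P₂) :
    DV P₁ P₂ P₃ P₄ h12 h34 ∘ₗ DV P₁ P₄ P₃ P₂ h14 h32 = LinearMap.id := by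
  refine LinearMap.ext fun x => ?_
  change P₁.projectionOnto P₂ h12 (P₃.projectionOnto P₄ h34
    (P₁.projectionOnto P₄ h14 (P₃.projectionOnto P₂ h32 (x : V) : V) : V) : V) = x
  have h1 := aux_sub P₃ P₂ h32 (x : V)
  generalize P₃.projectionOnto P₂ h32 (x : V) = y at *
  have h2 := aux_sub P₁ P₄ h14 (y : V)
  generalize P₁.projectionOnto P₄ h14 (y : V) = z at *
  rw [aux_proj P₃ P₄ h34 y z (by simpa using P₄.neg_mem h2)]
  exact aux_proj P₁ P₂ h12 x y (by simpa using P₂.neg_mem h1)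
end

section
/- Let V be a vector space over a field K, let P₁, P₂ be subspaces, and let Q₁, Q₂, Q₃ be subspaces such that V = Pᵢ ⊕ Qⱼ for all i ∈ {1,2} and j ∈ {1,2,3}. Then the composition of the six projections P₁ →(parallel to Q₂)→ P₂ →(parallel to Q₁)→ P₁ →(parallel to Q₁)→ P₂ →(parallel to Q₃)→ P₁ →(parallel to Q₃)→ P₂ →(parallel to Q₂)→ P₁ is the identity on P₁. Equivalently, with DV(P₁,Qₐ;P₂,Q_b) : P₁ → P₁ denoting the composition of the projection of P₁ onto P₂ parallel to Q_b followed by the projection of P₂ onto P₁ parallel to Qₐ, one has DV(P₁,Q₁;P₂,Q₂) ∘ DV(P₁,Q₃;P₂,Q₁) ∘ DV(P₁,Q₂;P₂,Q₃) = id (the cocycle property of the operator cross ratio). -/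
theorem proj_back_aux {K V : Type*} [Field K] [AddCommGroup V] [Module K V]
    (P P' Q : Submodule K V) (h : IsCompl P Q) (h' : IsCompl P' Q) (x : P) :
    P.projectionOnto Q h (P'.projectionOnto Q h' (x : V) : V) = x := by
  have h1 : (x : V) - (P'.projectionOnto Q h' (x : V) : V) ∈ Q := by
    simpa using Submodule.sub_projection_mem h' (x : V)
  have h2 := (Submodule.projectionOnto_apply_eq_zero_iff h).2 h1
  rw [map_sub, Submodule.projectionOnto_apply_left, sub_eq_zero] at h2
  exact h2.symm

/-- **cocycle property of the operator cross ratio.**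
If `V = Pᵢ ⊕ Qⱼ` for `i ∈ {1,2}`, `j ∈ {1,2,3}`, then the composition of the six
projections
`P₁ →(∥Q₂)→ P₂ →(∥Q₁)→ P₁ →(∥Q₁)→ P₂ →(∥Q₃)→ P₁ →(∥Q₃)→ P₂ →(∥Q₂)→ P₁`
is the identity on `P₁`; grouping consecutive pairs of projections, this reads
`DV(P₁,Q₂;P₂,Q₃) ∘ DV(P₁,Q₃;P₂,Q₁) ∘ DV(P₁,Q₁;P₂,Q₂) = id` (with the rightmost
factor applied first, so that the factors act in the order
`DV(P₁,Q₁;P₂,Q₂)`, `DV(P₁,Q₃;P₂,Q₁)`, `DV(P₁,Q₂;P₂,Q₃)`, exactly as in the chain). -/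
theorem DV_cocycle {K V : Type*} [Field K] [AddCommGroup V] [Module K V]
    (P₁ P₂ Q₁ Q₂ Q₃ : Submodule K V)
    (h11 : IsCompl P₁ Q₁) (h12 : IsCompl P₁ Q₂) (h13 : IsCompl P₁ Q₃)
    (h21 : IsCompl P₂ Q₁) (h22 : IsCompl P₂ Q₂) (h23 : IsCompl P₂ Q₃) :
    DV P₁ Q₂ P₂ Q₃ h12 h23 ∘ₗ DV P₁ Q₃ P₂ Q₁ h13 h21 ∘ₗ DV P₁ Q₁ P₂ Q₂ h11 h22 =
      LinearMap.id := by
  ext x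
  simp only [DV, Submodule.linearProjOfIsCompl, LinearMap.comp_apply, Submodule.subtype_apply,
    proj_back_aux, LinearMap.id_apply]
end

section
/- Let n ≥ 1, let z : ℝ → Matₙ(ℝ) be three times continuously differentiable with z'(t) invertible for every t, and let A : ℝ → Matₙ(ℝ) be continuously differentiable. Define W(t) = −½ (z'(t))⁻¹ z''(t) − A(t). Then for every t, W'(t) + W(t)² + W(t)A(t) + A(t)W(t) = −½ S(z)(t) − A'(t) − A(t)², where S(z) is the Schwarz operator of z. (This is the corrected form of the identity relating W to the Schwarz operator; the correction adds the term −A².) -/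
theorem aux_alg {n : ℕ} (a b c d e : Matrix (Fin n) (Fin n) ℝ) :
    (-(1 / 2 : ℝ) • (-(a * b * a) * b + a * c) - d) + (-(1 / 2 : ℝ) • (a * b) - e) ^ 2 +
      (-(1 / 2 : ℝ) • (a * b) - e) * e + e * (-(1 / 2 : ℝ) • (a * b) - e) =
    -(1 / 2 : ℝ) • (a * c - (3 / 2 : ℝ) • (a * b) ^ 2) - d - e ^ 2 := by
  simp only [pow_two, mul_sub, sub_mul, smul_mul_assoc, mul_smul_comm, neg_mul, mul_assoc]
  module

theorem aux_mul {n : ℕ} {f g : ℝ → Matrix (Fin n) (Fin n) ℝ} {f' g' : Matrix (Fin n) (Fin n) ℝ} {t : ℝ}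
    (hf : HasDerivAt f f' t) (hg : HasDerivAt g g' t) :
    HasDerivAt (fun s => f s * g s) (f' * g t + f t * g') t :=
  @HasDerivAt.mul ℝ _ t (Matrix (Fin n) (Fin n) ℝ) Matrix.linftyOpNormedRing Matrix.linftyOpNormedAlgebra f g f' g' hf hg

theorem aux_inv {n : ℕ} {f : ℝ → Matrix (Fin n) (Fin n) ℝ} {f' : Matrix (Fin n) (Fin n) ℝ} {t : ℝ}
    (hf : HasDerivAt f f' t) (hu : IsUnit (f t)) :
    HasDerivAt (fun s => (f s)⁻¹) (-((f t)⁻¹ * f' * (f t)⁻¹)) t := by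
  obtain ⟨u, hu⟩ := hu
  have h := @hasFDerivAt_ringInverse ℝ _ (Matrix (Fin n) (Fin n) ℝ) Matrix.linftyOpNormedRing
    (@instHasSummableGeomSeriesOfCompleteSpace _ Matrix.linftyOpNormedRing (inferInstanceAs (CompleteSpace (Fin n → Fin n → ℝ)))) Matrix.linftyOpNormedAlgebra u
  rw [hu] at h
  have h2 := @HasFDerivAt.comp_hasDerivAt ℝ _ (Matrix (Fin n) (Fin n) ℝ) Matrix.linftyOpNormedAddCommGroup Matrix.linftyOpNormedSpace (Matrix (Fin n) (Fin n) ℝ) Matrix.linftyOpNormedAddCommGroup Matrix.linftyOpNormedSpace f f' t _ _ h hf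
  have e : (fun s => (f s)⁻¹) = Ring.inverse ∘ f := by
    funext s; simp [Matrix.nonsing_inv_eq_ringInverse]
  rw [e, ← hu, ← Matrix.coe_units_inv]
  exact h2


attribute [local instance] Matrix.normedAddCommGroup Matrix.normedSpace

open Matrix

/-- The operator Schwarz derivative
`S(z)(t) = (z'(t))⁻¹ z'''(t) − (3/2) ((z'(t))⁻¹ z''(t))²`. -/
noncomputable def schwarzD {n : ℕ} (z : ℝ → Matrix (Fin n) (Fin n) ℝ) (t : ℝ) :
    Matrix (Fin n) (Fin n) ℝ :=
  (deriv z t)⁻¹ * deriv (deriv (deriv z)) t -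
    (3 / 2 : ℝ) • ((deriv z t)⁻¹ * deriv (deriv z) t) ^ 2

/-- Let `z : ℝ → Matₙ(ℝ)` be `C³` with `z'(t)` invertible for all
`t`, let `A : ℝ → Matₙ(ℝ)` be `C¹`, and set `W(t) = −½ (z'(t))⁻¹ z''(t) − A(t)`.
Then `W' + W² + WA + AW = −½ S(z) − A' − A²`. -/
theorem schwarz_riccati_identity
    (n : ℕ) (hn : 1 ≤ n) (z A : ℝ → Matrix (Fin n) (Fin n) ℝ)
    (hz : ContDiff ℝ 3 z) (hz' : ∀ t, IsUnit (deriv z t))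
    (hA : ContDiff ℝ 1 A) (t : ℝ) :
    deriv (fun s => -(1 / 2 : ℝ) • ((deriv z s)⁻¹ * deriv (deriv z) s) - A s) t +
        (-(1 / 2 : ℝ) • ((deriv z t)⁻¹ * deriv (deriv z) t) - A t) ^ 2 +
        (-(1 / 2 : ℝ) • ((deriv z t)⁻¹ * deriv (deriv z) t) - A t) * A t +
        A t * (-(1 / 2 : ℝ) • ((deriv z t)⁻¹ * deriv (deriv z) t) - A t) =
      -(1 / 2 : ℝ) • schwarzD z t - deriv A t - A t ^ 2 := by
  have h2 : ContDiff ℝ 2 (deriv z) := by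
    have : ContDiff ℝ (2+1) z := by norm_num; exact hz
    exact (contDiff_succ_iff_deriv.1 this).2.2
  have h3 : ContDiff ℝ 1 (deriv (deriv z)) := by
    have : ContDiff ℝ (1+1) (deriv z) := by rw [one_add_one_eq_two]; exact h2
    exact (contDiff_succ_iff_deriv.1 this).2.2
  have d1 := ((h2.differentiable (by norm_num)) t).hasDerivAt
  have d2 := ((h3.differentiable (by norm_num)) t).hasDerivAt
  have d3 := ((hA.differentiable (by norm_num)) t).hasDerivAt
  have h := (((aux_mul (aux_inv d1 (hz' t)) d2).const_smul (-(1/2:ℝ))).sub d3).deriv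
  have h' : deriv (fun s => -(1 / 2 : ℝ) • ((deriv z s)⁻¹ * deriv (deriv z) s) - A s) t = _ := h
  rw [h', schwarzD]
  exact aux_alg _ _ _ _ _
end

section
/- Let n ≥ 1, let A, B : ℝ → Matₙ(ℝ) with A continuously differentiable and A(t) symmetric for all t, and let z : ℝ → Matₙ(ℝ) be three times continuously differentiable with z'(t) invertible for every t. Suppose z satisfies the Schwarz equation S(z)(t) = 2(B(t) − A'(t) − A(t)²) for all t. Then W(t) := −½ (z'(t))⁻¹ z''(t) − A(t) is a solution of the matrix Riccati equation W'(t) = −B(t) − A(t)W(t) − W(t)A(t) − W(t)² for all t. (The Riccati equation is the projection of the linear Hamiltonian system q' = Aq + p, p' = −Bq − Aᵀp to the coordinate W = pq⁻¹.) -/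
attribute [local instance] Matrix.normedAddCommGroup Matrix.normedSpace

open Matrix

/-- product and inverse rule in a complete normed algebra -/
theorem aux_ring {R : Type*} [NormedRing R] [NormedAlgebra ℝ R] [CompleteSpace R]
    (f g : ℝ → R) (f' g' : R) (t : ℝ) (hu : IsUnit (f t))
    (hf : HasDerivAt f f' t) (hg : HasDerivAt g g' t) :
    HasDerivAt (fun s => Ring.inverse (f s) * g s)
      (Ring.inverse (f t) * g' - Ring.inverse (f t) * f' * Ring.inverse (f t) * g t) t := by
  obtain ⟨u, hu⟩ := hu
  have h1 := hasFDerivAt_ringInverse (𝕜 := ℝ) u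
  rw [hu] at h1
  have h2 := (h1.comp_hasDerivAt t hf).mul hg
  have e : Ring.inverse (f t) = ((u⁻¹ : Rˣ) : R) := by rw [← hu, Ring.inverse_unit]
  refine HasDerivAt.congr_deriv h2 ?_
  simp only [Function.comp_apply, e, ContinuousLinearMap.neg_apply,
    ContinuousLinearMap.mulLeftRight_apply]
  noncomm_ring

section
attribute [-instance] Matrix.normedAddCommGroup Matrix.normedSpace
attribute [local instance] Matrix.linftyOpNormedRing Matrix.linftyOpNormedAlgebra
theorem aux_mat {n : ℕ} (f g : ℝ → Matrix (Fin n) (Fin n) ℝ) (f' g' : Matrix (Fin n) (Fin n) ℝ)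
    (t : ℝ) (hu : IsUnit (f t))
    (hf : HasDerivAt f f' t) (hg : HasDerivAt g g' t) :
    HasDerivAt (fun s => (f s)⁻¹ * g s)
      ((f t)⁻¹ * g' - (f t)⁻¹ * f' * (f t)⁻¹ * g t) t := by
  have : CompleteSpace (Matrix (Fin n) (Fin n) ℝ) := FiniteDimensional.complete ℝ _
  have h := aux_ring f g f' g' t hu hf hg
  simp only [← Matrix.nonsing_inv_eq_ringInverse] at h
  exact h
end

/-- Let `A` be `C¹` and symmetric, `B` arbitrary, and let
`z : ℝ → Matₙ(ℝ)` be `C³` with `z'(t)` invertible.  If `z` satisfies the Schwarz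
equation `S(z) = 2(B − A' − A²)`, then `W := −½ (z')⁻¹ z'' − A` solves the matrix
Riccati equation `W' = −B − AW − WA − W²`. -/
theorem schwarz_equation_gives_riccati_solution
    (n : ℕ) (hn : 1 ≤ n) (A B z : ℝ → Matrix (Fin n) (Fin n) ℝ)
    (hA : ContDiff ℝ 1 A) (hAsymm : ∀ t, (A t)ᵀ = A t)
    (hz : ContDiff ℝ 3 z) (hz' : ∀ t, IsUnit (deriv z t))
    (hschwarz : ∀ t, schwarzD z t = (2 : ℝ) • (B t - deriv A t - A t ^ 2)) :
    ∀ t, HasDerivAt (fun s => -(1 / 2 : ℝ) • ((deriv z s)⁻¹ * deriv (deriv z) s) - A s)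
      (-(B t) -
        A t * (-(1 / 2 : ℝ) • ((deriv z t)⁻¹ * deriv (deriv z) t) - A t) -
        (-(1 / 2 : ℝ) • ((deriv z t)⁻¹ * deriv (deriv z) t) - A t) * A t -
        (-(1 / 2 : ℝ) • ((deriv z t)⁻¹ * deriv (deriv z) t) - A t) ^ 2) t := by
  intro t
  have hz1 : ContDiff ℝ 2 (deriv z) := hz.deriv'
  have hz2 : ContDiff ℝ 1 (deriv (deriv z)) := hz1.deriv'
  have d1 : HasDerivAt (deriv z) (deriv (deriv z) t) t :=
    (hz1.differentiable (by norm_num) t).hasDerivAt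
  have d2 : HasDerivAt (deriv (deriv z)) (deriv (deriv (deriv z)) t) t :=
    (hz2.differentiable (by norm_num) t).hasDerivAt
  have dA : HasDerivAt A (deriv A t) t := (hA.differentiable (by norm_num) t).hasDerivAt
  have key : HasDerivAt (fun s => (deriv z s)⁻¹ * deriv (deriv z) s) _ t :=
    aux_mat (deriv z) (deriv (deriv z)) _ _ t (hz' t) d1 d2
  have h := (key.const_smul (-(1 / 2 : ℝ))).sub dA
  have hs := hschwarz t
  unfold schwarzD at hs
  have hB : B t = (1 / 2 : ℝ) • ((deriv z t)⁻¹ * deriv (deriv (deriv z)) t -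
    (3 / 2 : ℝ) • ((deriv z t)⁻¹ * deriv (deriv z) t) ^ 2) + deriv A t + A t ^ 2 := by
    rw [hs, smul_smul]
    norm_num
    abel
  refine HasDerivAt.congr_deriv h ?_
  rw [hB, Matrix.mul_assoc _ _ (deriv (deriv z) t)]
  generalize (deriv z t)⁻¹ * deriv (deriv z) t = u
  generalize (deriv z t)⁻¹ * deriv (deriv (deriv z)) t = v
  simp only [pow_two, mul_sub, sub_mul, smul_mul_assoc, mul_smul_comm, smul_sub, smul_smul]
  module
end

section
/- Let n ≥ 1, let A, B : ℝ → Matₙ(ℝ) with A continuously differentiable and A(t) symmetric for all t, and let W : ℝ → Matₙ(ℝ) be a continuously differentiable solution of the matrix Riccati equation W'(t) = −B(t) − A(t)W(t) − W(t)A(t) − W(t)². Let z : ℝ → Matₙ(ℝ) be three times continuously differentiable with z'(t) invertible for every t, and suppose z solves the linear equation z''(t) = −2 z'(t)(W(t) + A(t)) for all t (i.e. W = −½(z')⁻¹z'' − A). Then z satisfies the Schwarz equation S(z)(t) = 2(B(t) − A'(t) − A(t)²) for all t. -/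
attribute [local instance] Matrix.normedAddCommGroup Matrix.normedSpace

open Matrix

theorem hasDerivAt_matrix_mul_aux {n : ℕ} {P Q : ℝ → Matrix (Fin n) (Fin n) ℝ}
    {P' Q' : Matrix (Fin n) (Fin n) ℝ} {t : ℝ}
    (hP : HasDerivAt P P' t) (hQ : HasDerivAt Q Q' t) :
    HasDerivAt (fun s => P s * Q s) (P' * Q t + P t * Q') t := by
  have hP2 : ∀ i j, HasDerivAt (fun s => P s i j) (P' i j) t := fun i j =>
    hasDerivAt_pi.1 (hasDerivAt_pi.1 hP i) j
  have hQ2 : ∀ i j, HasDerivAt (fun s => Q s i j) (Q' i j) t := fun i j =>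
    hasDerivAt_pi.1 (hasDerivAt_pi.1 hQ i) j
  refine hasDerivAt_pi.2 fun i => hasDerivAt_pi.2 fun j => ?_
  have h := HasDerivAt.fun_sum (u := Finset.univ)
    (fun k _ => (hP2 i k).mul (hQ2 k j))
  have e : (P' * Q t + P t * Q') i j = ∑ k, (P' i k * Q t k j + P t i k * Q' k j) := by
    simp [Matrix.mul_apply, Finset.sum_add_distrib]
  rw [e]
  exact h

/-- Let `A` be `C¹` and symmetric, let `W` be a `C¹` solution of the
matrix Riccati equation `W' = −B − AW − WA − W²`, and let `z : ℝ → Matₙ(ℝ)` be `C³`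
with `z'(t)` invertible, solving the linear equation `z'' = −2 z'(W + A)` (i.e.
`W = −½ (z')⁻¹ z'' − A`).  Then `z` satisfies the Schwarz equation
`S(z) = 2(B − A' − A²)`. -/
theorem riccati_solution_gives_schwarz_equation
    (n : ℕ) (hn : 1 ≤ n) (A B W z : ℝ → Matrix (Fin n) (Fin n) ℝ)
    (hA : ContDiff ℝ 1 A) (hAsymm : ∀ t, (A t)ᵀ = A t)
    (hW : ContDiff ℝ 1 W)
    (hriccati : ∀ t, deriv W t = -(B t) - A t * W t - W t * A t - W t ^ 2)
    (hz : ContDiff ℝ 3 z) (hz' : ∀ t, IsUnit (deriv z t))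
    (hlin : ∀ t, deriv (deriv z) t = (-2 : ℝ) • (deriv z t * (W t + A t))) :
    ∀ t, schwarzD z t = (2 : ℝ) • (B t - deriv A t - A t ^ 2) := by
  intro t
  have hz1 : ContDiff ℝ 2 (deriv z) := by
    have : ContDiff ℝ (2 + 1) z := by
      have e : (2 + 1 : WithTop ℕ∞) = 3 := by norm_num
      rw [e]; exact hz
    exact (contDiff_succ_iff_deriv.1 this).2.2
  have dz : HasDerivAt (deriv z) (deriv (deriv z) t) t :=
    ((hz1.differentiable (by norm_num)) t).hasDerivAt
  have dA : HasDerivAt A (deriv A t) t := ((hA.differentiable (by norm_num)) t).hasDerivAt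
  have dW : HasDerivAt W (deriv W t) t := ((hW.differentiable (by norm_num)) t).hasDerivAt
  have h3 : deriv (deriv (deriv z)) t = (-2 : ℝ) • (deriv (deriv z) t * (W t + A t)
      + deriv z t * (deriv W t + deriv A t)) := by
    have h := (hasDerivAt_matrix_mul_aux dz (dW.add dA)).const_smul (-2 : ℝ)
    have e : deriv (deriv z) = fun s => (-2 : ℝ) • (deriv z s * (W s + A s)) := funext hlin
    rw [congrArg deriv e]
    exact h.deriv
  have hu : (deriv z t)⁻¹ * deriv z t = 1 :=
    Matrix.nonsing_inv_mul _ ((Matrix.isUnit_iff_isUnit_det _).1 (hz' t))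
  have hl : ∀ X, (deriv z t)⁻¹ * (deriv z t * X) = X := fun X => by
    rw [← Matrix.mul_assoc, hu, Matrix.one_mul]
  have key1 : (deriv z t)⁻¹ * deriv (deriv z) t = (-2 : ℝ) • (W t + A t) := by
    rw [hlin t, Matrix.mul_smul, hl]
  have key2 : (deriv z t)⁻¹ * deriv (deriv (deriv z)) t =
      (-2 : ℝ) • (((-2 : ℝ) • (W t + A t)) * (W t + A t) + (deriv W t + deriv A t)) := by
    rw [h3, Matrix.mul_smul, Matrix.mul_add, hl, ← Matrix.mul_assoc, key1]
  unfold schwarzD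
  rw [key1, key2, hriccati t]
  simp only [pow_two, Matrix.mul_smul, Matrix.smul_mul, Matrix.mul_add, Matrix.add_mul, smul_add]
  module
end

section
/- Let n ≥ 1 and let a, b, c, d be n×n real matrices such that the 2n×2n block matrix M = [[a, b], [c, d]] is invertible. Let P₁, P₂, P₃, P₄ be n×n real matrices such that a + bPᵢ is invertible for i = 1,…,4, and set P̃ᵢ = (c + dPᵢ)(a + bPᵢ)⁻¹ (the Möbius transform of Pᵢ by M). Assume P₁ − P₂ and P₃ − P₄ are invertible. Then P̃₁ − P̃₂ and P̃₃ − P̃₄ are invertible, and there exists an invertible n×n matrix K such that (P̃₁−P̃₂)⁻¹(P̃₂−P̃₃)(P̃₃−P̃₄)⁻¹(P̃₄−P̃₁) = K (P₁−P₂)⁻¹(P₂−P₃)(P₃−P₄)⁻¹(P₄−P₁) K⁻¹; i.e., the similarity class of the matrix cross-ratio is invariant under Möbius transformations. -/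
open Matrix

/-- The Möbius transform `P ↦ (c + dP)(a + bP)⁻¹` of a matrix coordinate `P` by the
block matrix `[[a,b],[c,d]]`. -/
noncomputable def moebius {n : ℕ} (a b c d P : Matrix (Fin n) (Fin n) ℝ) :
    Matrix (Fin n) (Fin n) ℝ :=
  (c + d * P) * (a + b * P)⁻¹

lemma moebius_sub_aux {n : ℕ} (a b c d P Q : Matrix (Fin n) (Fin n) ℝ)
    (hP : IsUnit (a + b * P)) (hQ : IsUnit (a + b * Q)) :
    moebius a b c d P - moebius a b c d Q =
      (d - moebius a b c d Q * b) * (P - Q) * (a + b * P)⁻¹ := by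
  have hP' := (Matrix.isUnit_iff_isUnit_det _).1 hP
  have hQ' := (Matrix.isUnit_iff_isUnit_det _).1 hQ
  have e1 : moebius a b c d P * (a + b * P) = c + d * P :=
    Matrix.nonsing_inv_mul_cancel_right _ _ hP'
  have e2 : moebius a b c d Q * (a + b * Q) = c + d * Q :=
    Matrix.nonsing_inv_mul_cancel_right _ _ hQ'
  apply hP.mul_right_cancel
  rw [Matrix.nonsing_inv_mul_cancel_right _ _ hP', sub_mul, e1]
  generalize moebius a b c d Q = m at *
  have e3 : c = m * (a + b * Q) - d * Q := by rw [e2]; abel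
  rw [e3]
  noncomm_ring

lemma moebius_schur_aux {n : ℕ} (a b c d Q : Matrix (Fin n) (Fin n) ℝ)
    (hM : IsUnit (Matrix.fromBlocks a b c d)) (hQ : IsUnit (a + b * Q)) :
    IsUnit (d - moebius a b c d Q * b) := by
  have h : Matrix.fromBlocks a b c d * Matrix.fromBlocks 1 0 Q 1 =
      Matrix.fromBlocks (a + b * Q) b (c + d * Q) d := by
    simp [Matrix.fromBlocks_multiply]
  have hd := congrArg Matrix.det h
  let _ := hQ.invertible
  rw [Matrix.det_mul, Matrix.det_fromBlocks_zero₁₂, Matrix.det_fromBlocks₁₁ (a + b * Q),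
    Matrix.invOf_eq_nonsing_inv] at hd
  simp only [Matrix.det_one, mul_one] at hd
  rw [Matrix.isUnit_iff_isUnit_det] at hM ⊢
  rw [hd] at hM
  exact isUnit_of_mul_isUnit_right hM

/-- Let `M = [[a,b],[c,d]]` be an invertible `2n × 2n` block matrix
and `P₁ P₂ P₃ P₄` matrices with `a + b Pᵢ` invertible; set `P̃ᵢ = (c + d Pᵢ)(a + b Pᵢ)⁻¹`.
If `P₁ − P₂` and `P₃ − P₄` are invertible, then so are `P̃₁ − P̃₂` and `P̃₃ − P̃₄`, and
the matrix cross-ratio of the `P̃ᵢ` is conjugate (similar) to that of the `Pᵢ`: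
the similarity class of the matrix cross-ratio is invariant under Möbius
transformations. -/
theorem crossRatio_moebius_invariant
    (n : ℕ) (hn : 1 ≤ n) (a b c d : Matrix (Fin n) (Fin n) ℝ)
    (hM : IsUnit (Matrix.fromBlocks a b c d))
    (P₁ P₂ P₃ P₄ : Matrix (Fin n) (Fin n) ℝ)
    (h₁ : IsUnit (a + b * P₁)) (h₂ : IsUnit (a + b * P₂))
    (h₃ : IsUnit (a + b * P₃)) (h₄ : IsUnit (a + b * P₄))
    (h12 : IsUnit (P₁ - P₂)) (h34 : IsUnit (P₃ - P₄)) :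
    IsUnit (moebius a b c d P₁ - moebius a b c d P₂) ∧
    IsUnit (moebius a b c d P₃ - moebius a b c d P₄) ∧
    ∃ K : Matrix (Fin n) (Fin n) ℝ, IsUnit K ∧
      (moebius a b c d P₁ - moebius a b c d P₂)⁻¹ *
          (moebius a b c d P₂ - moebius a b c d P₃) *
          (moebius a b c d P₃ - moebius a b c d P₄)⁻¹ *
          (moebius a b c d P₄ - moebius a b c d P₁) =
        K * ((P₁ - P₂)⁻¹ * (P₂ - P₃) * (P₃ - P₄)⁻¹ * (P₄ - P₁)) * K⁻¹ := by
  have hQ2 := moebius_schur_aux a b c d P₂ hM h₂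
  have hQ4 := moebius_schur_aux a b c d P₄ hM h₄
  have e12 := moebius_sub_aux a b c d P₁ P₂ h₁ h₂
  have e34 := moebius_sub_aux a b c d P₃ P₄ h₃ h₄
  have e23 : moebius a b c d P₂ - moebius a b c d P₃ =
      (d - moebius a b c d P₂ * b) * (P₂ - P₃) * (a + b * P₃)⁻¹ := by
    rw [← neg_sub, moebius_sub_aux a b c d P₃ P₂ h₃ h₂, ← neg_sub P₃ P₂]
    simp only [mul_neg, neg_mul]
  have e41 : moebius a b c d P₄ - moebius a b c d P₁ =
      (d - moebius a b c d P₄ * b) * (P₄ - P₁) * (a + b * P₁)⁻¹ := by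
    rw [← neg_sub, moebius_sub_aux a b c d P₁ P₄ h₁ h₄, ← neg_sub P₁ P₄]
    simp only [mul_neg, neg_mul]
  have h₁' := (Matrix.isUnit_iff_isUnit_det _).1 h₁
  have h₃' := (Matrix.isUnit_iff_isUnit_det _).1 h₃
  have hQ2' := (Matrix.isUnit_iff_isUnit_det _).1 hQ2
  have hQ4' := (Matrix.isUnit_iff_isUnit_det _).1 hQ4
  rw [e12, e23, e34, e41]
  refine ⟨(hQ2.mul h12).mul (Matrix.isUnit_nonsing_inv_iff.2 h₁),
    (hQ4.mul h34).mul (Matrix.isUnit_nonsing_inv_iff.2 h₃), a + b * P₁, h₁, ?_⟩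
  simp only [Matrix.mul_inv_rev, Matrix.nonsing_inv_nonsing_inv _ h₁',
    Matrix.nonsing_inv_nonsing_inv _ h₃', Matrix.mul_assoc]
  rw [Matrix.nonsing_inv_mul_cancel_left _ _ hQ2',
    Matrix.nonsing_inv_mul_cancel_left _ _ h₃',
    Matrix.nonsing_inv_mul_cancel_left _ _ hQ4']
end

section
/- Let n ≥ 1, let z : ℝ → Matₙ(ℝ) be three times continuously differentiable with z'(t) invertible for all t, and let C₁, C₂, C₃, C₄ be n×n real matrices such that C₃z(t) + C₄ is invertible for all t. Define the Möbius transform w(t) = (C₁z(t) + C₂)(C₃z(t) + C₄)⁻¹ and assume w'(t) is invertible for all t. Then for every t there exists an invertible matrix K(t) such that S(w)(t) = K(t) S(z)(t) K(t)⁻¹; i.e., Möbius transforms of the preimage of the Schwarz operator lead to an isospectral (similarity) change of the image. -/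
attribute [local instance] Matrix.normedAddCommGroup Matrix.normedSpace

open Matrix

section
lemma dmul {n : ℕ} {f g : ℝ → Matrix (Fin n) (Fin n) ℝ} {f' g'} {t : ℝ}
    (hf : HasDerivAt f f' t) (hg : HasDerivAt g g' t) :
    HasDerivAt (fun s => f s * g s) (f' * g t + f t * g') t := by
  let _ := Matrix.linftyOpNormedRing (n := Fin n) (α := ℝ)
  let _ := Matrix.linftyOpNormedAlgebra (n := Fin n) (α := ℝ) (R := ℝ)
  exact HasDerivAt.mul (𝔸 := Matrix (Fin n) (Fin n) ℝ) (c := f) (d := g) hf hg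

lemma ginv {R : Type*} [NormedRing R] [NormedAlgebra ℝ R] [FiniteDimensional ℝ R]
    {f : ℝ → R} {t : ℝ} (hf : DifferentiableAt ℝ f t) (hu : IsUnit (f t)) :
    DifferentiableAt ℝ (fun s => Ring.inverse (f s)) t := by
  have _ : CompleteSpace R := FiniteDimensional.complete ℝ R
  exact hf.inverse hu

lemma dinv {n : ℕ} {f : ℝ → Matrix (Fin n) (Fin n) ℝ} {t : ℝ}
    (hf : DifferentiableAt ℝ f t) (hu : IsUnit (f t)) :
    DifferentiableAt ℝ (fun s => (f s)⁻¹) t := by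
  let _ := Matrix.linftyOpNormedRing (n := Fin n) (α := ℝ)
  let _ := Matrix.linftyOpNormedAlgebra (n := Fin n) (α := ℝ) (R := ℝ)
  have this := ginv (R := Matrix (Fin n) (Fin n) ℝ) (f := f) (t := t) hf hu
  simp only [Matrix.nonsing_inv_eq_ringInverse]
  exact this
end

/-- Pure algebra behind the theorem. -/
lemma schwarz_alg {n : ℕ} (v vi z1 zi z2 z3 B Bi C w1 w2 w3 : Matrix (Fin n) (Fin n) ℝ)
    (hv : v * vi = 1) (hv' : vi * v = 1) (hz : z1 * zi = 1) (hz' : zi * z1 = 1)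
    (hB' : Bi * B = 1) (hB : B * Bi = 1)
    (h1 : w1 = B * z1 * vi)
    (h2 : w2 = (B * z2 - (2 : ℝ) • (w1 * C * z1)) * vi)
    (h3 : w3 = (B * z3 - (3 : ℝ) • (w1 * C * z2) - (3 : ℝ) • (w2 * C * z1)) * vi) :
    w1⁻¹ * w3 - (3 / 2 : ℝ) • (w1⁻¹ * w2) ^ 2 =
      v * (zi * z3 - (3 / 2 : ℝ) • (zi * z2) ^ 2) * vi := by
  have c1 : ∀ X, v * (vi * X) = X := fun X => by rw [← mul_assoc, hv, one_mul]
  have c2 : ∀ X, vi * (v * X) = X := fun X => by rw [← mul_assoc, hv', one_mul]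
  have c3 : ∀ X, z1 * (zi * X) = X := fun X => by rw [← mul_assoc, hz, one_mul]
  have c4 : ∀ X, zi * (z1 * X) = X := fun X => by rw [← mul_assoc, hz', one_mul]
  have c5 : ∀ X, Bi * (B * X) = X := fun X => by rw [← mul_assoc, hB', one_mul]
  have hi : w1⁻¹ = v * (zi * Bi) := by
    apply Matrix.inv_eq_right_inv
    rw [h1]; simp only [mul_assoc, c2, c3, hB]
  have e1 : ∀ X, w1⁻¹ * (w1 * X) = X := fun X => by
    rw [hi, h1]; simp only [mul_assoc, c4, c5, c1]
  have hA : w1⁻¹ * w2 = v * (zi * z2 - (2 : ℝ) • (vi * C * z1)) * vi := by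
    rw [h2]
    simp only [sub_mul, mul_sub, smul_mul_assoc, mul_smul_comm, mul_assoc, e1, c1]
    rw [hi]; simp only [mul_assoc, c5]
  have hD : w1⁻¹ * w3 = v * (zi * z3 - (3 : ℝ) • (vi * C * z2)
      - (3 : ℝ) • ((zi * z2 - (2 : ℝ) • (vi * C * z1)) * (vi * C * z1))) * vi := by
    have : w1⁻¹ * w3 = (w1⁻¹ * (B * z3) - (3 : ℝ) • (w1⁻¹ * (w1 * (C * z2)))
        - (3 : ℝ) • ((w1⁻¹ * w2) * (C * z1))) * vi := by
      rw [h3]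
      simp only [sub_mul, mul_sub, smul_mul_assoc, mul_smul_comm, mul_assoc]
    rw [this, e1, hA, hi]
    simp only [sub_mul, mul_sub, smul_mul_assoc, mul_smul_comm, mul_assoc, c5, c1]
  rw [hA, hD]
  have hq : vi * C * z2 = (vi * C * z1) * (zi * z2) := by
    simp only [mul_assoc, c3]
  rw [hq]
  generalize vi * C * z1 = q
  generalize zi * z2 = a
  generalize zi * z3 = b
  have hsq : ∀ X, (v * X * vi) ^ 2 = v * X ^ 2 * vi := fun X => by
    simp only [pow_two, mul_assoc, c2]
  have hl : ∀ X Y : Matrix (Fin n) (Fin n) ℝ, v * X * vi - (3 / 2 : ℝ) • (v * Y * vi) =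
      v * (X - (3 / 2 : ℝ) • Y) * vi := fun X Y => by
    simp only [sub_mul, mul_sub, smul_mul_assoc, mul_smul_comm]
  rw [hsq, hl]
  congr 2
  simp only [pow_two, sub_mul, mul_sub, smul_mul_assoc, mul_smul_comm]
  module

/-- Let `z : ℝ → Matₙ(ℝ)` be `C³` with `z'(t)` invertible for all
`t`, let `C₁ C₂ C₃ C₄` be constant matrices with `C₃ z(t) + C₄` invertible for all
`t`, and let `w = (C₁ z + C₂)(C₃ z + C₄)⁻¹` be the Möbius transform of `z`, with
`w'(t)` invertible for all `t`.  Then for every `t` the Schwarz derivative of `w` is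
similar to that of `z`: `S(w)(t) = K(t) S(z)(t) K(t)⁻¹` for some invertible `K(t)`. -/
theorem schwarzD_moebius_isospectral
    (n : ℕ) (hn : 1 ≤ n) (z : ℝ → Matrix (Fin n) (Fin n) ℝ)
    (hz : ContDiff ℝ 3 z) (hz' : ∀ t, IsUnit (deriv z t))
    (C₁ C₂ C₃ C₄ : Matrix (Fin n) (Fin n) ℝ)
    (hC : ∀ t, IsUnit (C₃ * z t + C₄))
    (hw' : ∀ t, IsUnit (deriv (fun s => (C₁ * z s + C₂) * (C₃ * z s + C₄)⁻¹) t)) :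
    ∀ t, ∃ K : Matrix (Fin n) (Fin n) ℝ, IsUnit K ∧
      schwarzD (fun s => (C₁ * z s + C₂) * (C₃ * z s + C₄)⁻¹) t =
        K * schwarzD z t * K⁻¹ := by
  have hd0 : ∀ t, HasDerivAt z (deriv z t) t := fun t =>
    (hz.differentiable (by norm_num) t).hasDerivAt
  have hz2 : ContDiff ℝ 2 (deriv z) := ContDiff.deriv' (n := 2) (by
    have e : (2 + 1 : WithTop ℕ∞) = 3 := by norm_num
    rw [e]; exact hz)
  have hz3 : ContDiff ℝ 1 (deriv (deriv z)) := ContDiff.deriv' (n := 1) (by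
    have e : (1 + 1 : WithTop ℕ∞) = 2 := by norm_num
    rw [e]; exact hz2)
  have hd1 : ∀ t, HasDerivAt (deriv z) (deriv (deriv z) t) t := fun t =>
    (hz2.differentiable (by norm_num) t).hasDerivAt
  have hd2 : ∀ t, HasDerivAt (deriv (deriv z)) (deriv (deriv (deriv z)) t) t := fun t =>
    (hz3.differentiable (by norm_num) t).hasDerivAt
  have hdv : ∀ t, HasDerivAt (fun s => C₃ * z s + C₄) (C₃ * deriv z t) t := fun t => by
    have h := dmul (hasDerivAt_const t C₃) (hd0 t)
    rw [zero_mul, zero_add] at h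
    exact h.add_const C₄
  have hdP : ∀ t, HasDerivAt (fun s => C₁ * z s + C₂) (C₁ * deriv z t) t := fun t => by
    have h := dmul (hasDerivAt_const t C₁) (hd0 t)
    rw [zero_mul, zero_add] at h
    exact h.add_const C₂
  have hvi : ∀ t, (C₃ * z t + C₄) * (C₃ * z t + C₄)⁻¹ = 1 := fun t =>
    Matrix.mul_nonsing_inv _ ((Matrix.isUnit_iff_isUnit_det _).1 (hC t))
  have hvi' : ∀ t, (C₃ * z t + C₄)⁻¹ * (C₃ * z t + C₄) = 1 := fun t =>
    Matrix.nonsing_inv_mul _ ((Matrix.isUnit_iff_isUnit_det _).1 (hC t))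
  have hdi : ∀ t, HasDerivAt (fun s => (C₃ * z s + C₄)⁻¹) _ t := fun t =>
    (dinv (hdv t).differentiableAt (hC t)).hasDerivAt
  obtain ⟨w, hw⟩ : ∃ w, w = fun s => (C₁ * z s + C₂) * (C₃ * z s + C₄)⁻¹ := ⟨_, rfl⟩
  rw [← hw] at hw' ⊢
  have hwv : ∀ t, w t * (C₃ * z t + C₄) = C₁ * z t + C₂ := fun t => by
    rw [hw]; simp only [mul_assoc, hvi', mul_one]
  have hdw0 : ∀ t, HasDerivAt w (deriv w t) t := fun t => by
    rw [hw]; exact (dmul (hdP t) (hdi t)).differentiableAt.hasDerivAt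
  -- general tool: solve an equation `X * v = Y` for `X`
  have solve : ∀ t (X Y : Matrix (Fin n) (Fin n) ℝ), X * (C₃ * z t + C₄) = Y →
      X = Y * (C₃ * z t + C₄)⁻¹ := fun t X Y h => by
    rw [← h, mul_assoc, hvi, mul_one]
  have hE1 : ∀ t, deriv w t * (C₃ * z t + C₄) = (C₁ - w t * C₃) * deriv z t := fun t => by
    have h1 := dmul (hdw0 t) (hdv t)
    rw [funext hwv] at h1
    have := h1.unique (hdP t)
    rw [sub_mul, ← this]; simp only [mul_assoc]; abel
  have hdB : ∀ t, HasDerivAt (fun s => C₁ - w s * C₃) (-(deriv w t * C₃)) t := fun t => by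
    have h := dmul (hdw0 t) (hasDerivAt_const t C₃)
    rw [mul_zero, add_zero] at h
    exact h.const_sub C₁
  have hdw1 : ∀ t, HasDerivAt (deriv w) (deriv (deriv w) t) t := fun t => by
    have h : deriv w = fun s => (C₁ - w s * C₃) * deriv z s * (C₃ * z s + C₄)⁻¹ :=
      funext fun s => solve s _ _ (hE1 s)
    have h2 := dmul (dmul (hdB t) (hd1 t)) (hdi t)
    rw [← h] at h2
    exact h2.differentiableAt.hasDerivAt
  have hE2 : ∀ t, deriv (deriv w) t * (C₃ * z t + C₄) =
      (C₁ - w t * C₃) * deriv (deriv z) t - (2 : ℝ) • (deriv w t * C₃ * deriv z t) := fun t => by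
    have h1 := dmul (hdw1 t) (hdv t)
    rw [funext hE1] at h1
    have := h1.unique (dmul (hdB t) (hd1 t))
    rw [← eq_sub_iff_add_eq] at this
    rw [this, ← mul_assoc (deriv w t) C₃ (deriv z t), neg_mul]; module
  have hdR : ∀ t, HasDerivAt (fun t => (C₁ - w t * C₃) * deriv (deriv z) t
      - (2 : ℝ) • (deriv w t * C₃ * deriv z t)) _ t := fun t =>
    (dmul (hdB t) (hd2 t)).sub
      ((dmul (dmul (hdw1 t) (hasDerivAt_const t C₃)) (hd1 t)).const_smul (2 : ℝ))
  have hdw2 : ∀ t, HasDerivAt (deriv (deriv w)) (deriv (deriv (deriv w)) t) t := fun t => by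
    have h : deriv (deriv w) = fun s => _ := funext fun s => solve s _ _ (hE2 s)
    have h2 := dmul (hdR t) (hdi t)
    rw [← h] at h2
    exact h2.differentiableAt.hasDerivAt
  have hE3 : ∀ t, deriv (deriv (deriv w)) t * (C₃ * z t + C₄) =
      (C₁ - w t * C₃) * deriv (deriv (deriv z)) t
        - (3 : ℝ) • (deriv w t * C₃ * deriv (deriv z) t)
        - (3 : ℝ) • (deriv (deriv w) t * C₃ * deriv z t) := fun t => by
    have h1 := dmul (hdw2 t) (hdv t)
    rw [funext hE2] at h1
    have := h1.unique (hdR t)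
    rw [← eq_sub_iff_add_eq] at this
    rw [this, ← mul_assoc (deriv (deriv w) t) C₃ (deriv z t), neg_mul, mul_zero, add_zero]
    module
  intro t
  refine ⟨C₃ * z t + C₄, hC t, ?_⟩
  have hzd := (Matrix.isUnit_iff_isUnit_det _).1 (hz' t)
  have hBu : IsUnit (C₁ - w t * C₃) := by
    have h : C₁ - w t * C₃ = deriv w t * (C₃ * z t + C₄) * (deriv z t)⁻¹ := by
      rw [hE1, mul_assoc, Matrix.mul_nonsing_inv _ hzd, mul_one]
    rw [h]
    exact ((hw' t).mul (hC t)).mul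
      ((Matrix.isUnit_nonsing_inv_iff).2 (hz' t))
  have hBd := (Matrix.isUnit_iff_isUnit_det _).1 hBu
  exact schwarz_alg _ _ _ _ _ _ _ _ C₃ _ _ _ (hvi t) (hvi' t)
    (Matrix.mul_nonsing_inv _ hzd) (Matrix.nonsing_inv_mul _ hzd)
    (Matrix.nonsing_inv_mul _ hBd) (Matrix.mul_nonsing_inv _ hBd)
    (solve t _ _ (hE1 t)) (solve t _ _ (hE2 t)) (solve t _ _ (hE3 t))
end

section
/- Let n ≥ 1 and let z : ℝ → Matₙ(ℝ) be three times continuously differentiable with z'(0) invertible. Then z(s) − z(0) is invertible for all sufficiently small s ≠ 0, and lim_{s→0} 6 s⁻² ( s² · (z(s) − z(0))⁻¹ z'(s) (z(s) − z(0))⁻¹ z'(0) − Id ) = S(z)(0); i.e., the degenerate operator cross ratio has the asymptotic expansion s²·(z(s)−z(0))⁻¹ z'(s) (z(s)−z(0))⁻¹ z'(0) = Id + (s²/6) S(z)(0) + o(s²), exhibiting the Schwarz operator as the second-order term of the cross ratio of infinitesimally close subspaces. -/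
attribute [local instance] Matrix.normedAddCommGroup Matrix.normedSpace

open Matrix Filter

lemma aux_taylor3 {E : Type*} [NormedAddCommGroup E] [NormedSpace ℝ E] (f : ℝ → E)
    (hf : ContDiff ℝ 3 f) :
    Tendsto (fun s : ℝ => (s ^ 3)⁻¹ • (f s - f 0 - s • deriv f 0 -
      (s ^ 2 / 2) • deriv (deriv f) 0)) (nhdsWithin (0 : ℝ) {(0 : ℝ)}ᶜ)
      (nhds ((1 / 6 : ℝ) • deriv (deriv (deriv f)) 0)) := by
  have h := taylor_tendsto (f := f) (x₀ := 0) (n := 3) convex_univ (Set.mem_univ _)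
    (by simpa using hf.contDiffOn)
  rw [nhdsWithin_univ] at h
  have h2 := (h.mono_left (nhdsWithin_le_nhds (s := {(0 : ℝ)}ᶜ))).add_const
    ((1 / 6 : ℝ) • deriv (deriv (deriv f)) 0)
  rw [zero_add] at h2
  refine h2.congr' ?_
  filter_upwards [self_mem_nhdsWithin] with s hs
  have hs : s ≠ 0 := hs
  simp only [taylorWithinEval_succ, taylor_within_zero_eval, iteratedDerivWithin_univ,
    iteratedDeriv_succ, iteratedDeriv_zero, sub_zero]
  norm_num [Nat.factorial]
  match_scalars <;> field_simp <;> norm_num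

lemma aux_taylor2 {E : Type*} [NormedAddCommGroup E] [NormedSpace ℝ E] (f : ℝ → E)
    (hf : ContDiff ℝ 2 f) :
    Tendsto (fun s : ℝ => (s ^ 2)⁻¹ • (f s - f 0 - s • deriv f 0))
      (nhdsWithin (0 : ℝ) {(0 : ℝ)}ᶜ)
      (nhds ((1 / 2 : ℝ) • deriv (deriv f) 0)) := by
  have h := taylor_tendsto (f := f) (x₀ := 0) (n := 2) convex_univ (Set.mem_univ _)
    (by simpa using hf.contDiffOn)
  rw [nhdsWithin_univ] at h
  have h2 := (h.mono_left (nhdsWithin_le_nhds (s := {(0 : ℝ)}ᶜ))).add_const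
    ((1 / 2 : ℝ) • deriv (deriv f) 0)
  rw [zero_add] at h2
  refine h2.congr' ?_
  filter_upwards [self_mem_nhdsWithin] with s hs
  have hs : s ≠ 0 := hs
  simp only [taylorWithinEval_succ, taylor_within_zero_eval, iteratedDerivWithin_univ,
    iteratedDeriv_succ, iteratedDeriv_zero, sub_zero]
  norm_num [Nat.factorial]
  match_scalars <;> field_simp <;> norm_num

lemma aux_alg_s17 {n : ℕ} (s : ℝ) (hs : s ≠ 0) (Z Z' z1 U V a B C : Matrix (Fin n) (Fin n) ℝ)
    (h1 : IsUnit z1) (hUu : IsUnit U)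
    (hU : U = 1 + (s / 2) • a + s ^ 2 • B) (hV : V = 1 + s • a + s ^ 2 • C)
    (hZ : Z = s • (z1 * U)) (hZ' : Z' = z1 * V) :
    (6 / s ^ 2) • (s ^ 2 • (Z⁻¹ * Z' * Z⁻¹ * z1) - 1) =
      U⁻¹ * ((6 : ℝ) • (C - (1 / 4 : ℝ) • (a * a) - (2 : ℝ) • B -
        (s / 2) • (a * B + B * a) - s ^ 2 • (B * B))) * U⁻¹ := by
  have d1 := (Matrix.isUnit_iff_isUnit_det _).1 h1
  have dU := (Matrix.isUnit_iff_isUnit_det _).1 hUu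
  have hZi : Z⁻¹ = s⁻¹ • (U⁻¹ * z1⁻¹) := by
    apply Matrix.inv_eq_left_inv
    rw [hZ, smul_mul_smul_comm, inv_mul_cancel₀ hs, one_smul, Matrix.mul_assoc,
      Matrix.nonsing_inv_mul_cancel_left _ _ d1, Matrix.nonsing_inv_mul _ dU]
  have e1 : s ^ 2 • (Z⁻¹ * Z' * Z⁻¹ * z1) = U⁻¹ * V * U⁻¹ := by
    rw [hZi, hZ']
    simp only [smul_mul_assoc, mul_smul_comm, Matrix.mul_assoc, smul_smul,
      Matrix.nonsing_inv_mul _ d1, Matrix.nonsing_inv_mul_cancel_left _ _ d1, Matrix.mul_one]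
    rw [show s ^ 2 * (s⁻¹ * s⁻¹) = 1 by field_simp, one_smul]
  have e2 : U⁻¹ * V * U⁻¹ - 1 = U⁻¹ * (V - U * U) * U⁻¹ := by
    rw [Matrix.mul_sub, Matrix.sub_mul, Matrix.nonsing_inv_mul_cancel_left _ _ dU,
      Matrix.mul_nonsing_inv _ dU]
  have e3 : V - U * U = s ^ 2 • (C - (1 / 4 : ℝ) • (a * a) - (2 : ℝ) • B -
        (s / 2) • (a * B + B * a) - s ^ 2 • (B * B)) := by
    rw [hU, hV]
    simp only [mul_add, add_mul, smul_mul_assoc, mul_smul_comm, one_mul, mul_one]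
    module
  rw [e1, e2, e3]
  simp only [smul_mul_assoc, mul_smul_comm]
  rw [smul_smul, div_mul_cancel₀ _ (pow_ne_zero 2 hs)]

/-- Let `z : ℝ → Matₙ(ℝ)` be `C³` with `z'(0)` invertible.  Then
`z(s) − z(0)` is invertible for all sufficiently small `s ≠ 0`, and
`6 s⁻² (s² (z(s) − z(0))⁻¹ z'(s) (z(s) − z(0))⁻¹ z'(0) − Id) → S(z)(0)` as `s → 0`,
`s ≠ 0`; i.e. the degenerate cross ratio has the asymptotics
`s² (z(s)−z(0))⁻¹ z'(s) (z(s)−z(0))⁻¹ z'(0) = Id + (s²/6) S(z)(0) + o(s²)`. -/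
theorem crossRatio_asymptotics_schwarzD
    (n : ℕ) (hn : 1 ≤ n) (z : ℝ → Matrix (Fin n) (Fin n) ℝ)
    (hz : ContDiff ℝ 3 z) (h0 : IsUnit (deriv z 0)) :
    (∀ᶠ s in nhdsWithin (0 : ℝ) {(0 : ℝ)}ᶜ, IsUnit (z s - z 0)) ∧
      Tendsto
        (fun s : ℝ =>
          (6 / s ^ 2) •
            (s ^ 2 • ((z s - z 0)⁻¹ * deriv z s * (z s - z 0)⁻¹ * deriv z 0) - 1))
        (nhdsWithin (0 : ℝ) {(0 : ℝ)}ᶜ) (nhds (schwarzD z 0)) := by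
  have cm : @ContinuousMul (Matrix (Fin n) (Fin n) ℝ)
      (PseudoMetricSpace.toUniformSpace.toTopologicalSpace) _ :=
    (inferInstance : @ContinuousMul (Matrix (Fin n) (Fin n) ℝ) instTopologicalSpaceMatrix _)
  set F := nhdsWithin (0 : ℝ) {(0 : ℝ)}ᶜ with hF
  have d1 := (Matrix.isUnit_iff_isUnit_det _).1 h0
  obtain ⟨z1, hz1⟩ : ∃ x, x = deriv z 0 := ⟨_, rfl⟩
  obtain ⟨z2, hz2⟩ : ∃ x, x = deriv (deriv z) 0 := ⟨_, rfl⟩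
  obtain ⟨z3, hz3⟩ : ∃ x, x = deriv (deriv (deriv z)) 0 := ⟨_, rfl⟩
  have t3 : Tendsto (fun s : ℝ => (s ^ 3)⁻¹ • (z s - z 0 - s • z1 - (s ^ 2 / 2) • z2)) F
      (nhds ((1 / 6 : ℝ) • z3)) := by
    rw [hz1, hz2, hz3]
    exact aux_taylor3 z hz
  have t2 : Tendsto (fun s : ℝ => (s ^ 2)⁻¹ • (deriv z s - z1 - s • z2)) F
      (nhds ((1 / 2 : ℝ) • z3)) := by
    rw [hz1, hz2, hz3]
    exact aux_taylor2 (deriv z) ((contDiff_succ_iff_deriv (n := 2)).1 hz).2.2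
  unfold schwarzD
  simp only [← hz1, ← hz2, ← hz3] at h0 d1 ⊢
  set a := z1⁻¹ * z2 with ha
  set B : ℝ → Matrix (Fin n) (Fin n) ℝ :=
    fun s => z1⁻¹ * ((s ^ 3)⁻¹ • (z s - z 0 - s • z1 - (s ^ 2 / 2) • z2)) with hB
  set C : ℝ → Matrix (Fin n) (Fin n) ℝ :=
    fun s => z1⁻¹ * ((s ^ 2)⁻¹ • (deriv z s - z1 - s • z2)) with hC
  have tB : Tendsto B F (nhds (z1⁻¹ * ((1 / 6 : ℝ) • z3))) := t3.const_mul z1⁻¹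
  have tC : Tendsto C F (nhds (z1⁻¹ * ((1 / 2 : ℝ) • z3))) := t2.const_mul z1⁻¹
  have ts : Tendsto (fun s : ℝ => s) F (nhds 0) := tendsto_id.mono_left nhdsWithin_le_nhds
  set U : ℝ → Matrix (Fin n) (Fin n) ℝ := fun s => 1 + (s / 2) • a + s ^ 2 • B s with hU
  have tU : Tendsto U F (nhds 1) := by
    have := ((ts.div_const 2).smul_const a).const_add 1 |>.add ((ts.pow 2).smul tB)
    simpa using this
  have tUdet : Tendsto (fun s => (U s).det) F (nhds 1) := by
    have := ((continuous_id.matrix_det (n := Fin n) (R := ℝ)).tendsto 1).comp tU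
    simpa [Function.comp_def] using this
  have hUu : ∀ᶠ s in F, IsUnit (U s) := by
    filter_upwards [tUdet.eventually_ne one_ne_zero] with s hs
    exact (Matrix.isUnit_iff_isUnit_det _).2 (isUnit_iff_ne_zero.2 hs)
  have tUi : Tendsto (fun s => (U s)⁻¹) F (nhds 1) := by
    have hc : ContinuousAt (Inv.inv : Matrix (Fin n) (Fin n) ℝ → _) 1 := by
      apply continuousAt_matrix_inv
      rw [Matrix.det_one, Ring.inverse_eq_inv']
      exact continuousAt_inv₀ one_ne_zero
    have := hc.tendsto.comp tU
    simpa [Function.comp_def] using this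
  have hne : ∀ᶠ s in F, s ≠ 0 := self_mem_nhdsWithin
  have hZ : ∀ s : ℝ, s ≠ 0 → z s - z 0 = s • (z1 * U s) := by
    intro s hs
    simp only [hU, hB, ha, mul_add, mul_smul_comm, Matrix.mul_one,
      Matrix.mul_nonsing_inv_cancel_left _ _ d1]
    match_scalars <;> field_simp <;> norm_num
  have hZ' : ∀ s : ℝ, s ≠ 0 → deriv z s = z1 * (1 + s • a + s ^ 2 • C s) := by
    intro s hs
    simp only [hC, ha, mul_add, mul_smul_comm, Matrix.mul_one,
      Matrix.mul_nonsing_inv_cancel_left _ _ d1]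
    match_scalars <;> field_simp <;> norm_num
  constructor
  · filter_upwards [hUu, hne] with s hs h
    rw [hZ s h]
    exact ((h0.mul hs).smul (Units.mk0 s h) :)
  · have tm : Tendsto (fun s => (U s)⁻¹ * ((6 : ℝ) • (C s - (1 / 4 : ℝ) • (a * a) - (2 : ℝ) • B s -
        (s / 2) • (a * B s + B s * a) - s ^ 2 • (B s * B s))) * (U s)⁻¹) F
        (nhds (1 * ((6 : ℝ) • (z1⁻¹ * ((1 / 2 : ℝ) • z3) - (1 / 4 : ℝ) • (a * a) -
          (2 : ℝ) • (z1⁻¹ * ((1 / 6 : ℝ) • z3)) -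
        ((0 : ℝ) / 2) • (a * (z1⁻¹ * ((1 / 6 : ℝ) • z3)) + (z1⁻¹ * ((1 / 6 : ℝ) • z3)) * a) -
        (0 : ℝ) ^ 2 • ((z1⁻¹ * ((1 / 6 : ℝ) • z3)) * (z1⁻¹ * ((1 / 6 : ℝ) • z3))))) * 1)) := by
      refine (tUi.mul (Tendsto.const_smul ?_ _)).mul tUi
      refine (((tC.sub_const _).sub (tB.const_smul _)).sub
        ((ts.div_const 2).smul ((tB.const_mul a).add (tB.mul_const a)))).sub
        ((ts.pow 2).smul (tB.mul tB))
    refine (tm.congr' ?_).trans_eq ?_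
    · filter_upwards [hUu, hne] with s hs h
      exact (aux_alg_s17 s h _ _ z1 (U s) _ a (B s) (C s) h0 hs rfl rfl (hZ s h) (hZ' s h)).symm
    · congr 1
      simp only [mul_smul_comm, one_mul, mul_one, pow_two]
      module
end

section
/- Let n ≥ 1, let z : ℝ → Matₙ(ℝ) be continuously differentiable, and fix s₁ such that z(s₁) − z(0) is invertible. Consider the cross-ratio function f(s₂, s₃) = (z(s₂) − z(s₁))⁻¹ (z(s₁) − z(0)) (z(0) − z(s₃))⁻¹ (z(s₃) − z(s₂)), defined for (s₂, s₃) in a neighbourhood of (0, s₁) (where the inverted matrices are invertible by continuity). Then f(0, s₃) = Id for all admissible s₃, ∂f/∂s₂(0, s₃) = −(z(0) − z(s₁))⁻¹ z'(0) + (z(0) − z(s₃))⁻¹ z'(0), and the mixed partial derivative satisfies ∂²f/∂s₃∂s₂ (0, s₁) = (z(s₁) − z(0))⁻¹ z'(s₁) (z(s₁) − z(0))⁻¹ z'(0). (This corrects the sign in formula (z) of the paper, consistently with the asymptotic expansion defining the Schwarz operator.) -/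
attribute [local instance] Matrix.normedAddCommGroup Matrix.normedSpace

open Matrix

/-- The cross-ratio function
`f(s₂, s₃) = (z(s₂) − z(s₁))⁻¹ (z(s₁) − z(0)) (z(0) − z(s₃))⁻¹ (z(s₃) − z(s₂))`
of the four points `z(s₂), z(s₁), z(0), z(s₃)` on a matrix curve `z`. -/
noncomputable def crossRatioCurve {n : ℕ} (z : ℝ → Matrix (Fin n) (Fin n) ℝ)
    (s₁ s₂ s₃ : ℝ) : Matrix (Fin n) (Fin n) ℝ :=
  (z s₂ - z s₁)⁻¹ * (z s₁ - z 0) * (z 0 - z s₃)⁻¹ * (z s₃ - z s₂)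

section Helpers

theorem ring_inv_hasDerivAt {R : Type*} [NormedRing R] [NormedAlgebra ℝ R] [CompleteSpace R]
    {f : ℝ → R} {f' : R} {x : ℝ} (hf : HasDerivAt f f' x) (hu : IsUnit (f x)) :
    HasDerivAt (fun t => Ring.inverse (f t)) (-(Ring.inverse (f x) * f' * Ring.inverse (f x))) x := by
  obtain ⟨u, hu⟩ := hu
  have h := hasFDerivAt_ringInverse (𝕜 := ℝ) u
  rw [hu] at h
  have := h.comp_hasDerivAt x hf
  rw [← hu]
  simpa [Function.comp_def] using this

variable {n : ℕ}

theorem mat_mul_hasDerivAt {f g : ℝ → Matrix (Fin n) (Fin n) ℝ} {f' g' : Matrix (Fin n) (Fin n) ℝ}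
    {x : ℝ} (hf : HasDerivAt f f' x) (hg : HasDerivAt g g' x) :
    HasDerivAt (fun t => f t * g t) (f' * g x + f x * g') x :=
  @HasDerivAt.fun_mul ℝ _ x (Matrix (Fin n) (Fin n) ℝ) Matrix.linftyOpNormedRing
    Matrix.linftyOpNormedAlgebra f g f' g' hf hg

theorem mat_inv_hasDerivAt {f : ℝ → Matrix (Fin n) (Fin n) ℝ} {f' : Matrix (Fin n) (Fin n) ℝ}
    {x : ℝ} (hf : HasDerivAt f f' x) (hu : IsUnit (f x)) :
    HasDerivAt (fun t => (f t)⁻¹) (-((f x)⁻¹ * f' * (f x)⁻¹)) x := by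
  simp only [Matrix.nonsing_inv_eq_ringInverse]
  have hc : CompleteSpace (Matrix (Fin n) (Fin n) ℝ) := FiniteDimensional.complete ℝ _
  exact @ring_inv_hasDerivAt (Matrix (Fin n) (Fin n) ℝ) Matrix.linftyOpNormedRing
    Matrix.linftyOpNormedAlgebra hc f f' x hf hu

end Helpers

/-- Let `z : ℝ → Matₙ(ℝ)` be `C¹` and let `s₁` be such that
`z(s₁) − z(0)` is invertible.  For the cross ratio
`f(s₂, s₃) = (z(s₂) − z(s₁))⁻¹ (z(s₁) − z(0)) (z(0) − z(s₃))⁻¹ (z(s₃) − z(s₂))` one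
has `f(0, s₃) = Id` (for admissible `s₃`), the first partial derivative
`∂f/∂s₂(0, s₃) = −(z(0) − z(s₁))⁻¹ z'(0) + (z(0) − z(s₃))⁻¹ z'(0)`, and the mixed
partial derivative
`∂²f/∂s₃∂s₂(0, s₁) = (z(s₁) − z(0))⁻¹ z'(s₁) (z(s₁) − z(0))⁻¹ z'(0)`. -/
theorem crossRatioCurve_partials
    (n : ℕ) (hn : 1 ≤ n) (z : ℝ → Matrix (Fin n) (Fin n) ℝ)
    (hz : ContDiff ℝ 1 z) (s₁ : ℝ) (hs₁ : IsUnit (z s₁ - z 0)) :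
    (∀ s₃, IsUnit (z 0 - z s₃) → crossRatioCurve z s₁ 0 s₃ = 1) ∧
    (∀ s₃, IsUnit (z 0 - z s₃) →
      deriv (fun s₂ => crossRatioCurve z s₁ s₂ s₃) 0 =
        -((z 0 - z s₁)⁻¹ * deriv z 0) + (z 0 - z s₃)⁻¹ * deriv z 0) ∧
    deriv (fun s₃ => deriv (fun s₂ => crossRatioCurve z s₁ s₂ s₃) 0) s₁ =
      (z s₁ - z 0)⁻¹ * deriv z s₁ * ((z s₁ - z 0)⁻¹ * deriv z 0) := by
  have hd : ∀ s, HasDerivAt z (deriv z s) s := fun s =>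
    ((hz.differentiable (by norm_num)) s).hasDerivAt
  have hs₁' : IsUnit (z 0 - z s₁) := by simpa using hs₁.neg
  have e1 : (z 0 - z s₁)⁻¹ * (z s₁ - z 0) = -1 := by
    rw [← neg_sub (z 0) (z s₁), mul_neg,
      Matrix.nonsing_inv_mul _ ((Matrix.isUnit_iff_isUnit_det _).1 hs₁')]
  have e2 : ∀ s₃, IsUnit (z 0 - z s₃) → (z 0 - z s₃)⁻¹ * (z s₃ - z 0) = -1 := by
    intro s₃ h
    rw [← neg_sub (z 0) (z s₃), mul_neg,
      Matrix.nonsing_inv_mul _ ((Matrix.isUnit_iff_isUnit_det _).1 h)]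
  have hP : ∀ s₃, IsUnit (z 0 - z s₃) →
      deriv (fun s₂ => crossRatioCurve z s₁ s₂ s₃) 0 =
        -((z 0 - z s₁)⁻¹ * deriv z 0) + (z 0 - z s₃)⁻¹ * deriv z 0 := by
    intro s₃ h
    have h1 := mat_inv_hasDerivAt ((hd 0).sub_const (z s₁)) hs₁'
    have h2 := mat_mul_hasDerivAt h1 (hasDerivAt_const (0 : ℝ) ((z s₁ - z 0) * (z 0 - z s₃)⁻¹))
    have h3 := mat_mul_hasDerivAt h2 ((hd 0).const_sub (z s₃))
    have h4 : (fun s₂ => crossRatioCurve z s₁ s₂ s₃) =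
        fun t => (z t - z s₁)⁻¹ * ((z s₁ - z 0) * (z 0 - z s₃)⁻¹) * (z s₃ - z t) := by
      funext t
      simp only [crossRatioCurve, mul_assoc]
    rw [h4]
    refine h3.deriv.trans ?_
    have e3 := e2 s₃ h
    have a1 : ∀ X, (z 0 - z s₁)⁻¹ * ((z s₁ - z 0) * X) = -X := fun X => by
      rw [← mul_assoc, e1, neg_one_mul]
    simp only [mul_zero, add_zero, mul_assoc, neg_mul, a1, e3, mul_neg, neg_neg, mul_one]
  refine ⟨?_, hP, ?_⟩
  · intro s₃ h
    simp only [crossRatioCurve]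
    rw [e1, mul_assoc, e2 s₃ h]; simp
  · have hc : ContinuousAt (fun s => (z 0 - z s).det) s₁ := by
      have : Continuous z := hz.continuous
      exact (Continuous.matrix_det (continuous_const.sub this)).continuousAt
    have hev : ∀ᶠ s in nhds s₁, IsUnit (z 0 - z s) := by
      have h0 : (z 0 - z s₁).det ≠ 0 := ((Matrix.isUnit_iff_isUnit_det _).1 hs₁').ne_zero
      filter_upwards [hc.eventually_ne h0] with s hs
      exact (Matrix.isUnit_iff_isUnit_det _).2 hs.isUnit
    refine (Filter.EventuallyEq.deriv_eq (hev.mono hP)).trans ?_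
    have h1 := mat_inv_hasDerivAt ((hd s₁).const_sub (z 0)) hs₁'
    have h2 := (mat_mul_hasDerivAt h1 (hasDerivAt_const s₁ (deriv z 0))).const_add
      (-((z 0 - z s₁)⁻¹ * deriv z 0))
    refine h2.deriv.trans ?_
    have e : (z s₁ - z 0)⁻¹ = -(z 0 - z s₁)⁻¹ := by
      apply Matrix.inv_eq_left_inv
      rw [neg_mul, e1, neg_neg]
    rw [e]
    simp [mul_assoc]
end
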